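/- (Accretivity selection lemma.) Let T₀ ⊆ 𝐏⁺ be a convex tree and let b be a function satisfying ‖Π_{T₀}b‖_{L²} ≤ C₀|I_{T₀}|^{1/2} and |[b]_{I_{T₀}}| ≥ δ for some C₀, δ > 0. Then there exists 0 < ε < 1 depending only on C₀ and δ, and a family 𝐓 of pairwise disjoint convex subtrees of T₀ whose tops form a (1−ε)-packing of T₀, such that |[b]_{I_P}| > ε for all P ∈ T₀ \ ⋃_{T∈𝐓} T, and |[b]_{I_{P_T}}| ≤ ε for all T ∈ 𝐓. -/

import Mathlib

open MeasureTheory Set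

noncomputable section

namespace Dyadic

/-- A dyadic interval/lacunary tile: `I = [j·2^k, (j+1)·2^k)` with `-M ≤ k ≤ M`,
`I ⊆ [0, 2^M)`.  Lacunary tiles are in bijection with dyadic intervals, so we
identify the tile `P⁺(I) = I × [1/|I|, 2/|I|)` with the data of `I`. -/
structure Tile (M : ℕ) where
  j : ℤ
  k : ℤ
  hk_lb : -(M : ℤ) ≤ k
  hk_ub : k ≤ (M : ℤ)
  hj : 0 ≤ j
  hsub : ((j : ℝ) + 1) * 2 ^ k ≤ 2 ^ (M : ℤ)

variable {M : ℕ}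

/-- The side length `|I_P| = 2^k` of the spatial interval of the tile. -/
def Tile.len (P : Tile M) : ℝ := 2 ^ P.k

/-- The spatial interval `I_P` of the tile. -/
def Tile.ival (P : Tile M) : Set ℝ :=
  Ico ((P.j : ℝ) * 2 ^ P.k) (((P.j : ℝ) + 1) * 2 ^ P.k)

/-- The order `P ≤′ Q` on lacunary tiles: `I_P ⊆ I_Q`. -/
def Tile.le (P Q : Tile M) : Prop := P.ival ⊆ Q.ival

/-- A (lacunary) tree: a collection of tiles together with a top tile. -/
structure Tree (M : ℕ) where
  tiles : Set (Tile M)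
  top : Tile M
  top_mem : top ∈ tiles
  le_top : ∀ P ∈ tiles, P.le top

/-- `|I_T|`, the length of the spatial interval of the top of the tree. -/
def Tree.len (T : Tree M) : ℝ := T.top.len

/-- A collection of tiles is convex if `P₁ ≤′ P ≤′ P₂` with `P₁, P₂` in the
collection implies `P` is in the collection. -/
def IsConvex (PP : Set (Tile M)) : Prop :=
  ∀ P₁ ∈ PP, ∀ P₂ ∈ PP, ∀ P : Tile M, P₁.le P → P.le P₂ → P ∈ PP

/-- The size `‖a‖_{size(T)} = (1/|I_T|) Σ_{P ∈ T} a(P)` of `a` on a tree `T`. -/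
def treeSize (a : Tile M → ℝ) (T : Tree M) : ℝ :=
  (∑ᶠ P ∈ T.tiles, a P) / T.len

/-- The maximal size `‖a‖_{size*(PP)}`: the supremum of `‖a‖_{size(T)}` over all
convex trees `T ⊆ PP` (by convention `0` if there are none). -/
def maxSize (a : Tile M → ℝ) (PP : Set (Tile M)) : ℝ :=
  sSup (insert 0 {s : ℝ | ∃ T : Tree M, T.tiles ⊆ PP ∧ IsConvex T.tiles ∧ s = treeSize a T})

/-- The complete tree `Tree(P) = {Q : Q ≤′ P}`. -/
def cTree (P : Tile M) : Set (Tile M) := {Q : Tile M | Q.le P}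

/-- A tree `T` is complete with respect to `PP` if `T = Tree(P_T) ∩ PP`. -/
def Tree.IsCompleteIn (T : Tree M) (PP : Set (Tile M)) : Prop :=
  T.tiles = cTree T.top ∩ PP

/-- `QQ` is an `α`-packing of the tree `T`: `QQ ⊆ T` and `Σ_{P ∈ QQ} |I_P| ≤ α|I_T|`. -/
def IsPacking (α : ℝ) (QQ : Set (Tile M)) (T : Tree M) : Prop :=
  QQ ⊆ T.tiles ∧ (∑ᶠ P ∈ QQ, Tile.len P) ≤ α * T.len

/-- `QQ` is a uniform `α`-packing of the tree `T`:
`Σ_{P ∈ QQ, I_P ⊆ J} |I_P| ≤ α|J|` for every dyadic interval `J`. -/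
def IsUniformPacking (α : ℝ) (QQ : Set (Tile M)) (T : Tree M) : Prop :=
  QQ ⊆ T.tiles ∧
    ∀ J : Tile M, (∑ᶠ P ∈ {P ∈ QQ | P.ival ⊆ J.ival}, Tile.len P) ≤ α * J.len

/-- Left half of the spatial interval. -/
def Tile.left (P : Tile M) : Set ℝ :=
  Ico ((P.j : ℝ) * 2 ^ P.k) (((P.j : ℝ) + 1 / 2) * 2 ^ P.k)

/-- Right half of the spatial interval. -/
def Tile.right (P : Tile M) : Set ℝ :=
  Ico (((P.j : ℝ) + 1 / 2) * 2 ^ P.k) (((P.j : ℝ) + 1) * 2 ^ P.k)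

/-- The (mother) Haar wavelet `φ_P = |I_P|^{-1/2}(χ_{I_l} - χ_{I_r})`. -/
def Tile.haar (P : Tile M) : ℝ → ℝ := fun x =>
  (Real.sqrt P.len)⁻¹ * (P.left.indicator 1 x - P.right.indicator 1 x)

/-- The Haar (wavelet) coefficient `Wf(P) = ⟨f, φ_P⟩`. -/
def waveCoeff (f : ℝ → ℝ) (P : Tile M) : ℝ := ∫ x, f x * P.haar x

/-- The average `[f]_{I_P} = (1/|I_P|)∫_{I_P} f`. -/
def tileAvg (f : ℝ → ℝ) (P : Tile M) : ℝ := (∫ x in P.ival, f x) / P.len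

/-- The mean `‖f‖_{mean(P)} = (1/|I_P|)∫_{I_P} |f|`. -/
def tileMean (f : ℝ → ℝ) (P : Tile M) : ℝ := (∫ x in P.ival, |f x|) / P.len

/-- The maximal mean `‖f‖_{mean*(PP)} = sup_{P ∈ PP} ‖f‖_{mean(P)}`. -/
def maxMean (f : ℝ → ℝ) (PP : Set (Tile M)) : ℝ :=
  sSup (insert 0 (tileMean f '' PP))

/-- The dyadic BMO norm `‖f‖_{BMO} = ‖|Wf|²‖_{size*(PP⁺)}^{1/2}`. -/
def bmoNorm (M : ℕ) (f : ℝ → ℝ) : ℝ :=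
  Real.sqrt (maxSize (fun P : Tile M => waveCoeff f P ^ 2) univ)

/-- The grid interval `[j·2^{-M}, (j+1)·2^{-M})` at the finest scale. -/
def gridIval (M : ℕ) (j : ℤ) : Set ℝ :=
  Ico ((j : ℝ) * 2 ^ (-(M : ℤ))) (((j : ℝ) + 1) * 2 ^ (-(M : ℤ)))

/-- A dyadic test function: supported on `[0, 2^M)` and constant on every dyadic
interval of length `2^{-M}`. -/
def IsTestFun (M : ℕ) (f : ℝ → ℝ) : Prop :=
  (∀ x : ℝ, x ∉ Ico (0 : ℝ) (2 ^ (M : ℤ)) → f x = 0) ∧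
    ∀ j : ℤ, ∀ x ∈ gridIval M j, ∀ y ∈ gridIval M j, f x = f y

/-- The `L²` norm. -/
def l2Norm (f : ℝ → ℝ) : ℝ := Real.sqrt (∫ x, f x ^ 2)

/-- The `L^∞` norm (as a supremum of values; adequate for test functions). -/
def supNorm (f : ℝ → ℝ) : ℝ := ⨆ x : ℝ, |f x|

/-- The weak `L^r` quasinorm `sup_{λ>0} λ |{|h| ≥ λ}|^{1/r}`. -/
def weakNorm (r : ℝ) (h : ℝ → ℝ) : ℝ :=
  sSup {s : ℝ | ∃ l : ℝ, 0 < l ∧ s = l * (volume {x : ℝ | l ≤ |h x|}).toReal ^ (1 / r)}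

/-- The phase space projection `Π_T f = Σ_{P ∈ T} ⟨f, φ_P⟩ φ_P` onto a tree. -/
def treeProj (T : Tree M) (f : ℝ → ℝ) : ℝ → ℝ := fun x =>
  ∑ᶠ P ∈ T.tiles, waveCoeff f P * P.haar x

/-- The high-low paraproduct `π_hl(f,g) = Σ_P Wf(P) [g]_P φ_P`. -/
def paraHL (M : ℕ) (f g : ℝ → ℝ) : ℝ → ℝ := fun x =>
  ∑ᶠ P : Tile M, waveCoeff f P * tileAvg g P * P.haar x

/-- The low-high paraproduct `π_lh(f,g) = Σ_P [f]_P Wg(P) φ_P`. -/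
def paraLH (M : ℕ) (f g : ℝ → ℝ) : ℝ → ℝ := fun x =>
  ∑ᶠ P : Tile M, tileAvg f P * waveCoeff g P * P.haar x

/-- The high-high paraproduct `π_hh(f,g) = Σ_P Wf(P) Wg(P) χ_{I_P}/|I_P|`. -/
def paraHH (M : ℕ) (f g : ℝ → ℝ) : ℝ → ℝ := fun x =>
  ∑ᶠ P : Tile M, waveCoeff f P * waveCoeff g P * P.ival.indicator 1 x / P.len

/-- The constant function `1` on `[0, 2^M)`. -/
def oneFn (M : ℕ) : ℝ → ℝ := (Ico (0 : ℝ) (2 ^ (M : ℤ))).indicator 1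

/-- A perfect dyadic Calderón–Zygmund operator, recorded via its kernel `K` and
kernel constant `A₀`. -/
structure PDCZ (M : ℕ) where
  K : ℝ → ℝ → ℝ
  A₀ : ℝ
  hA₀ : 0 < A₀
  meas : Measurable (Function.uncurry K)
  bound : ∀ x y : ℝ, x ≠ y → |K x y| ≤ A₀ / |x - y|
  perfectX : ∀ I J : Tile M, Disjoint I.ival J.ival →
    ∀ x ∈ I.ival, ∀ x' ∈ I.ival, ∀ y ∈ J.ival, K x y = K x' y
  perfectY : ∀ I J : Tile M, Disjoint I.ival J.ival →
    ∀ x ∈ I.ival, ∀ x' ∈ I.ival, ∀ y ∈ J.ival, K y x = K y x'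
  diag : ∀ I : Tile M, I.k = -(M : ℤ) → ∀ x ∈ I.ival, ∀ y ∈ I.ival, K x y = 0
  corner₁ : ∀ x ∈ Ico (0 : ℝ) (2 ^ ((M : ℤ) - 1)),
    ∀ y ∈ Ico ((2 : ℝ) ^ ((M : ℤ) - 1)) (2 ^ (M : ℤ)), K x y = 0
  corner₂ : ∀ x ∈ Ico ((2 : ℝ) ^ ((M : ℤ) - 1)) (2 ^ (M : ℤ)),
    ∀ y ∈ Ico (0 : ℝ) (2 ^ ((M : ℤ) - 1)), K x y = 0

/-- `Tf(x) = ∫ K(x,y) f(y) dy`. -/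
def PDCZ.app (Op : PDCZ M) (f : ℝ → ℝ) : ℝ → ℝ := fun x => ∫ y, Op.K x y * f y

/-- The transpose `T*f(x) = ∫ K(y,x) f(y) dy`. -/
def PDCZ.appT (Op : PDCZ M) (f : ℝ → ℝ) : ℝ → ℝ := fun x => ∫ y, Op.K y x * f y

/-- Complex-valued Haar coefficient. -/
def waveCoeffC (b : ℝ → ℂ) (P : Tile M) : ℂ := ∫ x, b x * (P.haar x : ℂ)

/-- Complex-valued average. -/
def tileAvgC (b : ℝ → ℂ) (P : Tile M) : ℂ := (∫ x in P.ival, b x) / (P.len : ℂ)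

/-- BMO norm of a complex-valued function. -/
def bmoNormC (M : ℕ) (b : ℝ → ℂ) : ℝ :=
  Real.sqrt (maxSize (fun P : Tile M => ‖waveCoeffC b P‖ ^ 2) univ)

/-- Complex-valued dyadic test functions. -/
def IsTestFunC (M : ℕ) (b : ℝ → ℂ) : Prop :=
  (∀ x : ℝ, x ∉ Ico (0 : ℝ) (2 ^ (M : ℤ)) → b x = 0) ∧
    ∀ j : ℤ, ∀ x ∈ gridIval M j, ∀ y ∈ gridIval M j, b x = b y

/-- The operator applied to a complex-valued function. -/
def PDCZ.appC (Op : PDCZ M) (b : ℝ → ℂ) : ℝ → ℂ := fun x => ∫ y, (Op.K x y : ℂ) * b y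


def fl (k : ℤ) (x : ℝ) : ℤ := ⌊x / 2 ^ k⌋

theorem mem_Ico_iff_fl (j k : ℤ) (x : ℝ) :
    x ∈ Ico ((j : ℝ) * 2 ^ k) (((j : ℝ) + 1) * 2 ^ k) ↔ fl k x = j := by
  have h : (0 : ℝ) < 2 ^ k := by positivity
  rw [fl, Int.floor_eq_iff, mem_Ico, le_div_iff₀ h, div_lt_iff₀ h]

theorem fl_mono {k k' : ℤ} (h : k' ≤ k) {x y : ℝ} (hxy : fl k' x = fl k' y) :
    fl k x = fl k y := by
  obtain ⟨n, rfl⟩ : ∃ n : ℕ, k = k' + n := ⟨(k - k').toNat, by omega⟩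
  have key : ∀ z : ℝ, fl (k' + n) z = fl k' z / (2 ^ n : ℕ) := by
    intro z
    unfold fl
    rw [← Int.floor_div_natCast]
    congr 1
    rw [zpow_add₀ (by norm_num), div_div]
    simp
  rw [key, key, hxy]

theorem mem_ival_iff (P : Tile M) (x : ℝ) : x ∈ P.ival ↔ fl P.k x = P.j :=
  mem_Ico_iff_fl _ _ _

theorem left_eq (P : Tile M) : P.left = Ico (((2 * P.j : ℤ) : ℝ) * 2 ^ (P.k - 1))
    ((((2 * P.j : ℤ) : ℝ) + 1) * 2 ^ (P.k - 1)) := by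
  unfold Tile.left
  rw [zpow_sub_one₀ (by norm_num)]
  push_cast
  congr 1 <;> ring

theorem right_eq (P : Tile M) : P.right = Ico (((2 * P.j + 1 : ℤ) : ℝ) * 2 ^ (P.k - 1))
    ((((2 * P.j + 1 : ℤ) : ℝ) + 1) * 2 ^ (P.k - 1)) := by
  unfold Tile.right
  rw [zpow_sub_one₀ (by norm_num)]
  push_cast
  congr 1 <;> ring

theorem mem_left_iff (P : Tile M) (x : ℝ) : x ∈ P.left ↔ fl (P.k - 1) x = 2 * P.j := by
  rw [left_eq, mem_Ico_iff_fl]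

theorem mem_right_iff (P : Tile M) (x : ℝ) : x ∈ P.right ↔ fl (P.k - 1) x = 2 * P.j + 1 := by
  rw [right_eq, mem_Ico_iff_fl]

theorem len_pos (P : Tile M) : 0 < P.len := by unfold Tile.len; positivity

theorem left_union_right (P : Tile M) : P.left ∪ P.right = P.ival := by
  have := len_pos P
  unfold Tile.len at this
  unfold Tile.left Tile.right Tile.ival
  apply Ico_union_Ico_eq_Ico <;> nlinarith

theorem left_disj_right (P : Tile M) : Disjoint P.left P.right := by
  rw [Set.disjoint_left]
  intro x hx hx'
  rw [mem_left_iff] at hx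
  rw [mem_right_iff] at hx'
  omega

theorem vol_ival (P : Tile M) : volume.real P.ival = P.len := by
  have := len_pos P
  unfold Tile.len at this
  unfold Tile.ival Tile.len
  rw [Real.volume_real_Ico_of_le (by nlinarith)]
  ring

theorem vol_left (P : Tile M) : volume.real P.left = P.len / 2 := by
  have := len_pos P
  unfold Tile.len at this
  unfold Tile.left Tile.len
  rw [Real.volume_real_Ico_of_le (by nlinarith)]
  ring

theorem vol_right (P : Tile M) : volume.real P.right = P.len / 2 := by
  have := len_pos P
  unfold Tile.len at this
  unfold Tile.right Tile.len
  rw [Real.volume_real_Ico_of_le (by nlinarith)]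
  ring

theorem meas_ival (P : Tile M) : MeasurableSet P.ival := measurableSet_Ico
theorem meas_left (P : Tile M) : MeasurableSet P.left := measurableSet_Ico
theorem meas_right (P : Tile M) : MeasurableSet P.right := measurableSet_Ico

theorem tile_ext {P Q : Tile M} (hk : P.k = Q.k) (hj : P.j = Q.j) : P = Q := by
  cases P; cases Q; simp_all

theorem start_mem (P : Tile M) : (P.j : ℝ) * 2 ^ P.k ∈ P.ival := by
  have := len_pos P
  unfold Tile.len at this
  unfold Tile.ival
  rw [mem_Ico]
  constructor <;> nlinarith

theorem le_of_mem {P Q : Tile M} {x : ℝ} (hP : x ∈ P.ival) (hQ : x ∈ Q.ival) (h : P.k ≤ Q.k) :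
    P.le Q := by
  intro y hy
  rw [mem_ival_iff] at *
  rw [← hQ]
  exact fl_mono h (hy.trans hP.symm)

theorem k_le_of_le {P Q : Tile M} (h : P.le Q) : P.k ≤ Q.k := by
  have h1 : volume.real P.ival ≤ volume.real Q.ival :=
    measureReal_mono h (by unfold Tile.ival; simp)
  rw [vol_ival, vol_ival] at h1
  unfold Tile.len at h1
  exact (zpow_le_zpow_iff_right₀ (by norm_num)).1 h1

theorem eq_of_mem {P Q : Tile M} {x : ℝ} (hP : x ∈ P.ival) (hQ : x ∈ Q.ival) (h : P.k = Q.k) :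
    P = Q := by
  rw [mem_ival_iff] at *
  apply tile_ext h
  rw [← hP, ← hQ, h]

instance tileFinite (M : ℕ) : Finite (Tile M) := by
  have : Function.Injective (fun P : Tile M =>
      ((⟨P.j, by
          refine ⟨P.hj, ?_⟩
          have h1 := P.hsub
          have h2 : (2 : ℝ) ^ (-(M : ℤ)) ≤ 2 ^ P.k :=
            zpow_le_zpow_right₀ (by norm_num) P.hk_lb
          have h3 : (0 : ℝ) ≤ P.j := by exact_mod_cast P.hj
          have h4 : ((P.j : ℝ) + 1) * 2 ^ (-(M : ℤ)) ≤ 2 ^ (M : ℤ) :=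
            le_trans (mul_le_mul_of_nonneg_left h2 (by positivity)) h1
          rw [zpow_neg, ← div_eq_mul_inv, div_le_iff₀ (by positivity)] at h4
          have h5 : (P.j : ℝ) ≤ ((2 ^ M * 2 ^ M : ℤ) : ℝ) := by
            push_cast
            simp only [zpow_natCast] at h4
            linarith
          exact_mod_cast h5⟩ : Icc (0 : ℤ) (2 ^ M * 2 ^ M)),
       (⟨P.k, P.hk_lb, P.hk_ub⟩ : Icc (-(M : ℤ)) (M : ℤ)))) := by
    intro P Q h
    simp only [Prod.mk.injEq] at h
    exact tile_ext (congrArg Subtype.val h.2) (congrArg Subtype.val h.1)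
  exact Finite.of_injective _ this

theorem haar_memLp (P : Tile M) (p : ENNReal) : MemLp P.haar p volume := by
  unfold Tile.haar
  apply MemLp.const_mul
  have h1 : MemLp (P.left.indicator (fun _ => (1 : ℝ))) p volume :=
    memLp_indicator_const p (meas_left P) 1 (Or.inr (by unfold Tile.left; simp))
  have h2 : MemLp (P.right.indicator (fun _ => (1 : ℝ))) p volume :=
    memLp_indicator_const p (meas_right P) 1 (Or.inr (by unfold Tile.right; simp))
  exact h1.sub h2

theorem haar_integrable (P : Tile M) : Integrable P.haar volume :=
  memLp_one_iff_integrable.1 (haar_memLp P 1)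

theorem haar_eq_zero {P : Tile M} {x : ℝ} (hx : x ∉ P.ival) : P.haar x = 0 := by
  rw [← left_union_right, mem_union, not_or] at hx
  simp [Tile.haar, hx.1, hx.2]

theorem integral_haar (P : Tile M) : ∫ x, P.haar x = 0 := by
  unfold Tile.haar
  rw [integral_const_mul, integral_sub]
  · rw [integral_indicator_one (meas_left P), integral_indicator_one (meas_right P), vol_left,
      vol_right]
    simp
  · exact (integrable_indicator_iff (meas_left P)).2 (by
      unfold Tile.left; exact integrableOn_const (by simp))
  · exact (integrable_indicator_iff (meas_right P)).2 (by
      unfold Tile.right; exact integrableOn_const (by simp))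

/-- average of `haar Q` over `P` -/
def av (Q P : Tile M) : ℝ := (∫ x in P.ival, Q.haar x) / P.len

theorem av_zero {Q P : Tile M} (h : Q.k ≤ P.k) : av Q P = 0 := by
  unfold av
  rw [div_eq_zero_iff]
  left
  by_cases hd : ∃ x, x ∈ Q.ival ∧ x ∈ P.ival
  · obtain ⟨x, hx, hx'⟩ := hd
    rw [setIntegral_eq_integral_of_forall_compl_eq_zero, integral_haar]
    intro y hy
    exact haar_eq_zero fun hy' => hy (le_of_mem hx hx' h hy')
  · push Not at hd
    apply setIntegral_eq_zero_of_forall_eq_zero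
    intro x hx
    exact haar_eq_zero fun hx' => hd x hx' hx

theorem haar_const {Q P : Tile M} (h : P.k < Q.k) {x y : ℝ} (hx : x ∈ P.ival) (hy : y ∈ P.ival) :
    Q.haar x = Q.haar y := by
  rw [mem_ival_iff] at hx hy
  have h1 : fl (Q.k - 1) x = fl (Q.k - 1) y := fl_mono (by omega) (hx.trans hy.symm)
  unfold Tile.haar
  congr 2
  · by_cases h2 : x ∈ Q.left
    · have h3 : y ∈ Q.left := by rw [mem_left_iff] at *; omega
      simp [h2, h3]
    · have h3 : y ∉ Q.left := by rw [mem_left_iff] at *; omega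
      simp [h2, h3]
  · by_cases h2 : x ∈ Q.right
    · have h3 : y ∈ Q.right := by rw [mem_right_iff] at *; omega
      simp [h2, h3]
    · have h3 : y ∉ Q.right := by rw [mem_right_iff] at *; omega
      simp [h2, h3]

theorem av_eq {Q P : Tile M} (h : P.k < Q.k) {x : ℝ} (hx : x ∈ P.ival) : av Q P = Q.haar x := by
  unfold av
  rw [setIntegral_congr_fun (meas_ival P) (fun y hy => haar_const h hy hx), setIntegral_const,
    vol_ival, smul_eq_mul]
  field_simp [(len_pos P).ne']

theorem av_parent {Q P P' : Tile M} (hk : P'.k = P.k + 1) (hle : P.le P') (hne : Q ≠ P') :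
    av Q P = av Q P' := by
  rcases lt_trichotomy Q.k P'.k with h | h | h
  · rw [av_zero (by omega), av_zero (by omega)]
  · rw [av_zero (P := P') (by omega), av_eq (by omega) (start_mem P)]
    exact haar_eq_zero fun hx => hne (eq_of_mem hx (hle (start_mem P)) h)
  · rw [av_eq (by omega) (start_mem P), av_eq h (hle (start_mem P))]

theorem waveCoeff_eq (b : ℝ → ℝ) (hb : LocallyIntegrable b volume) (P : Tile M) :
    waveCoeff b P = (Real.sqrt P.len)⁻¹ * ((∫ x in P.left, b x) - ∫ x in P.right, b x) := by
  unfold waveCoeff Tile.haar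
  have hl : IntegrableOn b P.left volume :=
    (hb.integrableOn_isCompact isCompact_Icc).mono_set Ico_subset_Icc_self
  have hr : IntegrableOn b P.right volume :=
    (hb.integrableOn_isCompact isCompact_Icc).mono_set Ico_subset_Icc_self
  have : (fun x => b x * ((Real.sqrt P.len)⁻¹ * (P.left.indicator 1 x - P.right.indicator 1 x)))
      = fun x => (Real.sqrt P.len)⁻¹ * (P.left.indicator b x - P.right.indicator b x) := by
    ext x
    by_cases h1 : x ∈ P.left <;> by_cases h2 : x ∈ P.right <;> simp [h1, h2] <;> ring
  rw [this, integral_const_mul, integral_sub, integral_indicator (meas_left P),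
    integral_indicator (meas_right P)]
  · exact (integrable_indicator_iff (meas_left P)).2 hl
  · exact (integrable_indicator_iff (meas_right P)).2 hr

theorem avg_step (b : ℝ → ℝ) (hb : LocallyIntegrable b volume) {P P' : Tile M}
    (hk : P'.k = P.k + 1) (hle : P.le P') :
    tileAvg b P = tileAvg b P' + waveCoeff b P' * av P' P := by
  have hl : IntegrableOn b P'.left volume :=
    (hb.integrableOn_isCompact isCompact_Icc).mono_set Ico_subset_Icc_self
  have hr : IntegrableOn b P'.right volume :=
    (hb.integrableOn_isCompact isCompact_Icc).mono_set Ico_subset_Icc_self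
  have hs := start_mem P
  have hs' := hle hs
  have hlen : P'.len = 2 * P.len := by
    unfold Tile.len
    rw [hk, zpow_add_one₀ (by norm_num)]; ring
  have hpos := len_pos P
  have hsq : (Real.sqrt P'.len)⁻¹ * (Real.sqrt P'.len)⁻¹ = (2 * P.len)⁻¹ := by
    rw [← mul_inv, Real.mul_self_sqrt (len_pos P').le, hlen]
  rw [av_eq (by omega) hs, waveCoeff_eq b hb]
  unfold tileAvg
  rw [← left_union_right P', setIntegral_union (left_disj_right P') (meas_right P') hl hr, hlen]
  rw [← hlen]
  set x := (P.j : ℝ) * 2 ^ P.k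
  have hkk : P'.k - 1 = P.k := by omega
  rw [← left_union_right] at hs'
  rcases hs' with h | h
  · have h' : x ∉ P'.right := (left_disj_right P').notMem_of_mem_left h
    have e : P.ival = P'.left := by
      ext y
      rw [mem_left_iff] at h
      rw [mem_left_iff, mem_ival_iff, ← h, hkk, (mem_ival_iff P x).1 hs]
    rw [e]
    simp only [Tile.haar, h, h', indicator_of_mem, indicator_of_notMem, not_false_eq_true,
      Pi.one_apply]
    trans ((∫ x in P'.left, b x) + (∫ x in P'.right, b x)) / P'.len + (((Real.sqrt P'.len)⁻¹ * (Real.sqrt P'.len)⁻¹)) * ((∫ x in P'.left, b x) - ∫ x in P'.right, b x)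
    · rw [hsq, hlen]; field_simp; ring
    · ring
  · have h' : x ∉ P'.left := (left_disj_right P').notMem_of_mem_right h
    have e : P.ival = P'.right := by
      ext y
      rw [mem_right_iff] at h
      rw [mem_right_iff, mem_ival_iff, ← h, hkk, (mem_ival_iff P x).1 hs]
    rw [e]
    simp only [Tile.haar, h, h', indicator_of_mem, indicator_of_notMem, not_false_eq_true,
      Pi.one_apply]
    trans ((∫ x in P'.left, b x) + (∫ x in P'.right, b x)) / P'.len - (((Real.sqrt P'.len)⁻¹ * (Real.sqrt P'.len)⁻¹)) * ((∫ x in P'.left, b x) - ∫ x in P'.right, b x)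
    · rw [hsq, hlen]; field_simp; ring
    · ring

theorem exists_parent {P R : Tile M} (hle : P.le R) (hlt : P.k < R.k) :
    ∃ P' : Tile M, P'.k = P.k + 1 ∧ P.le P' ∧ P'.le R := by
  set x := (P.j : ℝ) * 2 ^ P.k with hx
  have hxP := start_mem P
  have hx0 : 0 ≤ x := by
    have : (0 : ℝ) ≤ P.j := by exact_mod_cast P.hj
    positivity
  have hsubR : Ico (((fl (P.k + 1) x : ℤ) : ℝ) * 2 ^ (P.k + 1))
      ((((fl (P.k + 1) x : ℤ) : ℝ) + 1) * 2 ^ (P.k + 1)) ⊆ R.ival := by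
    intro y hy
    rw [mem_Ico_iff_fl] at hy
    rw [mem_ival_iff, ← (mem_ival_iff R x).1 (hle hxP)]
    exact fl_mono (by omega) hy
  have hp : (0 : ℝ) < 2 ^ (P.k + 1) := by positivity
  refine ⟨⟨fl (P.k + 1) x, P.k + 1, by have := P.hk_lb; omega, by have := R.hk_ub; omega,
    Int.floor_nonneg.2 (by positivity), ?_⟩, rfl, ?_, hsubR⟩
  · refine le_trans ?_ R.hsub
    exact ((Ico_subset_Ico_iff (by nlinarith)).1 hsubR).2
  · exact le_of_mem hxP ((mem_ival_iff _ _).2 rfl) (by simp)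

theorem telescope (T : Tree M) (hT : IsConvex T.tiles) (b : ℝ → ℝ)
    (hb : LocallyIntegrable b volume) (n : ℕ) : ∀ P ∈ T.tiles, T.top.k - P.k = n →
    ∑ Q ∈ T.tiles.toFinite.toFinset, waveCoeff b Q * av Q P
      = tileAvg b P - tileAvg b T.top := by
  induction n with
  | zero =>
    intro P hP hk
    have : P = T.top := eq_of_mem (start_mem P) (T.le_top P hP (start_mem P)) (by omega)
    subst this
    rw [sub_self]
    apply Finset.sum_eq_zero
    intro Q hQ
    rw [av_zero (k_le_of_le (T.le_top Q (by simpa using hQ))), mul_zero]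
  | succ n ih =>
    intro P hP hk
    obtain ⟨P', hk', h1, h2⟩ := exists_parent (T.le_top P hP) (by omega)
    have hP' : P' ∈ T.tiles := hT P hP _ T.top_mem P' h1 h2
    have h3 := ih P' hP' (by omega)
    have hmem : P' ∈ T.tiles.toFinite.toFinset := by simpa using hP'
    classical
    rw [← Finset.add_sum_erase _ _ hmem] at h3 ⊢
    rw [av_zero le_rfl] at h3
    rw [avg_step b hb hk' h1, Finset.sum_congr rfl (g := fun Q => waveCoeff b Q * av Q P')]
    · linarith
    · intro Q hQ
      rw [av_parent hk' h1 (Finset.ne_of_mem_erase hQ)]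

theorem treeProj_eq (T : Tree M) (b : ℝ → ℝ) : treeProj T b =
    fun x => ∑ Q ∈ T.tiles.toFinite.toFinset, waveCoeff b Q * Q.haar x := by
  ext x
  unfold treeProj
  rw [finsum_mem_eq_finite_toFinset_sum _ T.tiles.toFinite]

theorem treeProj_memLp (T : Tree M) (b : ℝ → ℝ) (p : ENNReal) : MemLp (treeProj T b) p volume := by
  rw [treeProj_eq]
  exact memLp_finset_sum _ fun Q _ => (haar_memLp Q p).const_mul _

theorem setIntegral_treeProj (T : Tree M) (hT : IsConvex T.tiles) (b : ℝ → ℝ)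
    (hb : LocallyIntegrable b volume) {P : Tile M} (hP : P ∈ T.tiles) :
    ∫ x in P.ival, treeProj T b x = (tileAvg b P - tileAvg b T.top) * P.len := by
  rw [← telescope T hT b hb (T.top.k - P.k).toNat P hP
    (by have := k_le_of_le (T.le_top P hP); omega), treeProj_eq, integral_finset_sum]
  · rw [Finset.sum_mul]
    refine Finset.sum_congr rfl fun Q _ => ?_
    rw [integral_const_mul, av]
    field_simp [(len_pos P).ne']
  · intro Q _
    exact ((haar_integrable Q).const_mul _).integrableOn

theorem packing (T : Tree M) (hT : IsConvex T.tiles) (b : ℝ → ℝ)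
    (hb : LocallyIntegrable b volume) (C₀ δ ε : ℝ) (hC₀ : 0 < C₀) (hδ : 0 < δ) 
    (h1 : ε ≤ 1 / 2) (h2 : ε ≤ δ / 2) (h3 : ε * (32 * C₀ ^ 2) ≤ δ ^ 2)
    (hn : Real.sqrt (∫ x, treeProj T b x ^ 2) ≤ C₀ * Real.sqrt T.len)
    (ha : δ ≤ |tileAvg b T.top|) (S : Finset (Tile M)) (hS : ∀ P ∈ S, P ∈ T.tiles)
    (hSb : ∀ P ∈ S, |tileAvg b P| ≤ ε)
    (hd : (S : Set (Tile M)).PairwiseDisjoint Tile.ival) :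
    ∑ P ∈ S, P.len ≤ (1 - ε) * T.len := by
  set F := treeProj T b with hF
  have hFi : Integrable F volume := memLp_one_iff_integrable.1 (treeProj_memLp T b 1)
  have hF2 : Integrable (fun x => F x ^ 2) volume := (treeProj_memLp T b 2).integrable_sq
  set E : Set ℝ := ⋃ P ∈ S, P.ival with hE
  have hEm : MeasurableSet E := Finset.measurableSet_biUnion _ fun P _ => meas_ival P
  have hEsub : E ⊆ T.top.ival := iUnion₂_subset fun P hP => T.le_top P (hS P hP)
  have hfin : volume T.top.ival ≠ ⊤ := by unfold Tile.ival; simp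
  have hV : volume.real E = ∑ P ∈ S, P.len := by
    rw [hE, measureReal_biUnion_finset hd (fun P _ => meas_ival P)
      (fun P _ => by unfold Tile.ival; simp)]
    exact Finset.sum_congr rfl fun P _ => vol_ival P
  have hIE : ∫ x in E, F x = ∑ P ∈ S, (tileAvg b P - tileAvg b T.top) * P.len := by
    rw [hE, integral_biUnion_finset S (fun P _ => meas_ival P) hd (fun P _ => hFi.integrableOn)]
    exact Finset.sum_congr rfl fun P hP => setIntegral_treeProj T hT b hb (hS P hP)
  have hI : ∫ x in T.top.ival, F x = 0 := by
    rw [setIntegral_treeProj T hT b hb T.top_mem]; simp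
  set D := T.top.ival \ E with hD
  have hDm : MeasurableSet D := (meas_ival _).diff hEm
  have hDF : ∫ x in D, F x = - ∫ x in E, F x := by
    rw [hD, setIntegral_diff hEm hFi.integrableOn hEsub, hI, zero_sub]
  have hDV : volume.real D = T.len - ∑ P ∈ S, P.len := by
    rw [hD, measureReal_diff hEsub hEm hfin, hV, vol_ival, Tree.len]
  have hDfin : volume D ≠ ⊤ := ne_top_of_le_ne_top hfin (measure_mono diff_subset)
  have hL : 0 < T.len := len_pos _
  have hX : ∫ x in D, F x ^ 2 ≤ C₀ ^ 2 * T.len := by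
    have h4 : ∫ x in D, F x ^ 2 ≤ ∫ x, F x ^ 2 :=
      setIntegral_le_integral hF2 (Filter.Eventually.of_forall fun x => sq_nonneg _)
    have h5 : ∫ x, F x ^ 2 ≤ (C₀ * Real.sqrt T.len) ^ 2 := (Real.sqrt_le_left (by positivity)).1 hn
    rw [mul_pow, Real.sq_sqrt hL.le] at h5
    linarith
  have hquad : ∀ c : ℝ, 0 ≤ (∫ x in D, F x ^ 2) - 2 * c * (∫ x in D, F x)
      + c ^ 2 * volume.real D := by
    intro c
    have h6 : 0 ≤ ∫ x in D, (F x - c) ^ 2 := integral_nonneg fun x => sq_nonneg _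
    have h7 : ∫ x in D, (F x - c) ^ 2 = (∫ x in D, F x ^ 2) - 2 * c * (∫ x in D, F x)
      + c ^ 2 * volume.real D := by
      have : (fun x => (F x - c) ^ 2) = fun x => (F x ^ 2 - 2 * c * F x) + c ^ 2 := by
        ext x; ring
      rw [this, integral_add, integral_sub hF2.integrableOn (hFi.const_mul _).integrableOn,
        integral_const_mul, setIntegral_const, smul_eq_mul]
      · ring
      · exact hF2.integrableOn.sub (hFi.const_mul _).integrableOn
      · exact integrableOn_const hDfin
    linarith
  obtain ⟨s, hs2, hsa⟩ : ∃ s : ℝ, (s = 1 ∨ s = -1) ∧ |tileAvg b T.top| = s * tileAvg b T.top := by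
    rcases abs_choice (tileAvg b T.top) with h | h
    · exact ⟨1, Or.inl rfl, by rw [h]; ring⟩
    · exact ⟨-1, Or.inr rfl, by rw [h]; ring⟩
  set V := ∑ P ∈ S, P.len with hVdef
  have hY : δ / 2 * V ≤ s * ∫ x in D, F x := by
    rw [hDF, hIE, ← Finset.sum_neg_distrib, hVdef, Finset.mul_sum, Finset.mul_sum]
    refine Finset.sum_le_sum fun P hP => ?_
    have h8 := abs_le.1 (hSb P hP)
    have h9 : s * tileAvg b P ≤ ε := by
      rcases hs2 with rfl | rfl <;> linarith
    nlinarith [len_pos P]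
  by_contra hcon
  push Not at hcon
  have hq := hquad (s * (4 * C₀ ^ 2 / δ))
  have hss : s ^ 2 = 1 := by rcases hs2 with rfl | rfl <;> norm_num
  rw [hDV, mul_pow, hss] at hq
  set Y := ∫ x in D, F x
  set c := 4 * C₀ ^ 2 / δ with hc
  have hcpos : 0 < c := by positivity
  have hcd : c * δ = 4 * C₀ ^ 2 := by rw [hc]; field_simp
  have hVL : T.len / 2 ≤ V := by nlinarith
  have hY2 : δ / 4 * T.len ≤ s * Y := by nlinarith
  have e1 : c * (δ / 4 * T.len) ≤ c * (s * Y) := mul_le_mul_of_nonneg_left hY2 hcpos.le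
  have e2 : c ^ 2 * (T.len - V) ≤ c ^ 2 * (ε * T.len) :=
    mul_le_mul_of_nonneg_left (by linarith) (by positivity)
  have e3 : c ^ 2 * ε ≤ C₀ ^ 2 / 2 := by
    have : c ^ 2 * ε = C₀ ^ 2 / 2 * ((ε * (32 * C₀ ^ 2)) / δ ^ 2) := by
      rw [hc]; field_simp; ring
    rw [this]
    have : (ε * (32 * C₀ ^ 2)) / δ ^ 2 ≤ 1 := (div_le_one (by positivity)).2 h3
    nlinarith [sq_nonneg C₀]
  have e4 : c ^ 2 * ε * T.len ≤ C₀ ^ 2 / 2 * T.len := mul_le_mul_of_nonneg_right e3 hL.le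
  have e5 : 0 < C₀ ^ 2 * T.len := by positivity
  have e6 : c * (δ / 4 * T.len) = C₀ ^ 2 * T.len := by
    rw [show c * (δ / 4 * T.len) = c * δ / 4 * T.len by ring, hcd]; ring
  nlinarith

/-- Lemma 7.5: accretivity selection lemma. -/
theorem statement18 (C₀ δ : ℝ) (hC₀ : 0 < C₀) (hδ : 0 < δ) :
    ∃ ε : ℝ, 0 < ε ∧ ε < 1 ∧
      ∀ (M : ℕ) (T₀ : Tree M) (b : ℝ → ℝ),
        IsConvex T₀.tiles →
        LocallyIntegrable b volume →
        Real.sqrt (∫ x, treeProj T₀ b x ^ 2) ≤ C₀ * Real.sqrt T₀.len →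
        δ ≤ |tileAvg b T₀.top| →
        ∃ TT : Set (Tree M),
          (∀ T ∈ TT, T.tiles ⊆ T₀.tiles ∧ IsConvex T.tiles) ∧
          (TT.Pairwise fun T T' => Disjoint T.tiles T'.tiles) ∧
          (∀ T ∈ TT, T.top ∈ T₀.tiles) ∧
          (∑ᶠ T ∈ TT, Tile.len T.top) ≤ (1 - ε) * T₀.len ∧
          (∀ P ∈ T₀.tiles \ ⋃ T ∈ TT, T.tiles, ε < |tileAvg b P|) ∧
          (∀ T ∈ TT, |tileAvg b T.top| ≤ ε) := by
  obtain ⟨ε, h0, h1, h2, h3⟩ : ∃ ε : ℝ, 0 < ε ∧ ε ≤ 1 / 2 ∧ ε ≤ δ / 2 ∧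
      ε * (32 * C₀ ^ 2) ≤ δ ^ 2 := by
    refine ⟨min (1 / 2) (min (δ / 2) (δ ^ 2 / (32 * C₀ ^ 2))), by positivity, min_le_left _ _,
      (min_le_right _ _).trans (min_le_left _ _), ?_⟩
    rw [← le_div_iff₀ (by positivity)]
    exact (min_le_right _ _).trans (min_le_right _ _)
  refine ⟨ε, h0, by linarith, ?_⟩
  intro M T₀ b hT hb hn ha
  set B : Set (Tile M) := {P | P ∈ T₀.tiles ∧ |tileAvg b P| ≤ ε} with hB
  set S : Set (Tile M) := {P | P ∈ B ∧ ∀ Q ∈ B, P.le Q → Q = P} with hS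
  have hmax : ∀ P ∈ B, ∃ Q ∈ S, P.le Q := by
    intro P hP
    obtain ⟨Q, hQ, hQm⟩ := Set.exists_max_image {Q | Q ∈ B ∧ P.le Q} (fun Q => Q.k)
      (Set.toFinite _) ⟨P, hP, subset_rfl⟩
    refine ⟨Q, ⟨hQ.1, ?_⟩, hQ.2⟩
    intro R hR hQR
    have := hQm R ⟨hR, hQ.2.trans hQR⟩
    have h5 := k_le_of_le hQR
    exact (eq_of_mem (start_mem Q) (hQR (start_mem Q)) (le_antisymm h5 this)).symm
  have huniq : ∀ P ∈ S, ∀ Q ∈ S, ∀ x, x ∈ P.ival → x ∈ Q.ival → P = Q := by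
    intro P hP Q hQ x hx hx'
    rcases le_total P.k Q.k with h | h
    · exact (hP.2 Q hQ.1 (le_of_mem hx hx' h)).symm
    · exact hQ.2 P hP.1 (le_of_mem hx' hx h)
  set TT : Set (Tree M) := {T | T.top ∈ S ∧ T.tiles = {Q | Q ∈ T₀.tiles ∧ Q.le T.top}} with hTT
  have hinj : ∀ T ∈ TT, ∀ T' ∈ TT, T.top = T'.top → T = T' := by
    rintro ⟨t, p, _, _⟩ ⟨_, h⟩ ⟨t', p', _, _⟩ ⟨_, h'⟩ heq
    simp only at heq h h'
    subst heq
    rw [← h'] at h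
    subst h
    rfl
  have hbij : BijOn Tree.top TT S := by
    refine ⟨fun T h => h.1, fun T h T' h' => hinj T h T' h', fun P hP => ?_⟩
    exact ⟨⟨{Q | Q ∈ T₀.tiles ∧ Q.le P}, P, ⟨hP.1.1, subset_rfl⟩, fun Q hQ => hQ.2⟩, ⟨hP, rfl⟩, rfl⟩
  refine ⟨TT, ?_, ?_, fun T h => h.1.1.1, ?_, ?_, fun T h => h.1.1.2⟩
  · rintro T ⟨-, h⟩
    rw [h]
    refine ⟨fun Q hQ => hQ.1, fun P₁ hP₁ P₂ hP₂ P h1 h2 => ⟨hT P₁ hP₁.1 P₂ hP₂.1 P h1 h2,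
      h2.trans hP₂.2⟩⟩
  · intro T h T' h' hne
    rw [Set.disjoint_left]
    intro Q hQ hQ'
    rw [h.2] at hQ
    rw [h'.2] at hQ'
    exact hne (hinj T h T' h' (huniq _ h.1 _ h'.1 _ (hQ.2 (start_mem Q)) (hQ'.2 (start_mem Q))))
  · rw [finsum_mem_eq_of_bijOn Tree.top hbij (g := Tile.len) (fun _ _ => rfl),
      finsum_mem_eq_finite_toFinset_sum _ S.toFinite]
    refine packing T₀ hT b hb C₀ δ ε hC₀ hδ h1 h2 h3 hn ha _ ?_ ?_ ?_
    · intro P hP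
      rw [Set.Finite.mem_toFinset] at hP
      exact hP.1.1
    · intro P hP
      rw [Set.Finite.mem_toFinset] at hP
      exact hP.1.2
    · intro P hP Q hQ hne
      rw [Set.Finite.coe_toFinset] at hP hQ
      exact Set.disjoint_left.2 fun x hx hx' => hne (huniq P hP Q hQ x hx hx')
  · rintro P ⟨hP, hP'⟩
    by_contra hcon
    push Not at hcon
    obtain ⟨Q, hQ, hle⟩ := hmax P ⟨hP, hcon⟩
    obtain ⟨T, hTm, rfl⟩ := hbij.2.2 hQ
    apply hP'
    rw [mem_iUnion₂]
    refine ⟨T, hTm, ?_⟩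
    rw [hTm.2]
    exact ⟨hP, hle⟩

end Dyadic
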